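/- Let S be a Hausdorff topological space equipped with an associative multiplication • that is separately continuous (for every a ∈ S both x ↦ x•a and x ↦ a•x are continuous), and let I ⊆ S be a nonempty compact two-sided ideal. Then the Rees quotient S/ρ_I with the quotient topology and the induced multiplication is a semitopological semigroup with zero [I] (and a monoid with identity [e] if S is a monoid with identity e). If moreover s : S → S is a continuous involution (s∘s = id and s(x•y) = s(y)•s(x) for all x,y) with s(I) = I, then the induced map s_I on S/ρ_I (s_I([x]) = [s(x)]) is a continuous involution on S/ρ_I. -/

import Mathlib

/-- The Rees congruence associated to an ideal `I`: two elements are related iff they are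
equal or both belong to `I`. -/
def reesSetoid {S : Type*} (I : Set S) : Setoid S where
  r x y := x = y ∨ (x ∈ I ∧ y ∈ I)
  iseqv := by
    refine ⟨fun x => Or.inl rfl, ?_, ?_⟩
    · rintro x y (rfl | ⟨hx, hy⟩)
      · exact Or.inl rfl
      · exact Or.inr ⟨hy, hx⟩
    · rintro x y z (rfl | ⟨hx, hy⟩) (rfl | ⟨hy', hz⟩)
      · exact Or.inl rfl
      · exact Or.inr ⟨hy', hz⟩
      · exact Or.inr ⟨hx, hy⟩
      · exact Or.inr ⟨hx, hz⟩

/-- Rees quotient of a compact ideal in a semitopological semigroup: the induced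
multiplication is well defined, associative, has the class of `I` as absorbing zero, is
separately continuous, the class of an identity is an identity, and a continuous involution
preserving `I` descends to a continuous involution of the quotient. -/
theorem reesQuotient_semitopological
    {S : Type*} [TopologicalSpace S] [T2Space S]
    (mul : S → S → S)
    (h_assoc : ∀ x y z, mul (mul x y) z = mul x (mul y z))
    (h_rcont : ∀ a : S, Continuous fun x => mul x a)
    (h_lcont : ∀ a : S, Continuous fun x => mul a x)
    (I : Set S) (hI_ne : I.Nonempty) (hI_cpt : IsCompact I)
    (hI_ideal : ∀ s : S, ∀ i ∈ I, mul s i ∈ I ∧ mul i s ∈ I) :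
    ∃ m : Quotient (reesSetoid I) → Quotient (reesSetoid I) → Quotient (reesSetoid I),
      (∀ x y : S, m (Quotient.mk (reesSetoid I) x) (Quotient.mk (reesSetoid I) y)
          = Quotient.mk (reesSetoid I) (mul x y)) ∧
      (∀ p q r, m (m p q) r = m p (m q r)) ∧
      (∀ i ∈ I, ∀ p,
        m p (Quotient.mk (reesSetoid I) i) = Quotient.mk (reesSetoid I) i ∧
        m (Quotient.mk (reesSetoid I) i) p = Quotient.mk (reesSetoid I) i) ∧
      (∀ q, Continuous fun p => m p q) ∧
      (∀ q, Continuous fun p => m q p) ∧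
      (∀ e : S, (∀ x, mul e x = x) → (∀ x, mul x e = x) →
        ∀ p, m (Quotient.mk (reesSetoid I) e) p = p ∧
          m p (Quotient.mk (reesSetoid I) e) = p) ∧
      (∀ s : S → S, Continuous s → (∀ x, s (s x) = x) →
        (∀ x y, s (mul x y) = mul (s y) (s x)) → s '' I = I →
        ∃ sI : Quotient (reesSetoid I) → Quotient (reesSetoid I),
          (∀ x : S, sI (Quotient.mk (reesSetoid I) x) = Quotient.mk (reesSetoid I) (s x)) ∧
          Continuous sI ∧
          (∀ p, sI (sI p) = p) ∧
          (∀ p q, sI (m p q) = m (sI q) (sI p))) := by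
  have hq : ∀ x y : S, (x = y ∨ (x ∈ I ∧ y ∈ I)) →
      Quotient.mk (reesSetoid I) x = Quotient.mk (reesSetoid I) y :=
    fun x y h => Quotient.sound (s := reesSetoid I) h
  have hc : Continuous (Quotient.mk (reesSetoid I)) := continuous_quot_mk
  refine ⟨Quotient.lift₂ (s₁ := reesSetoid I) (s₂ := reesSetoid I)
    (fun x y => Quotient.mk (reesSetoid I) (mul x y)) ?_, ?_, ?_, ?_, ?_, ?_, ?_, ?_⟩
  · intro a b c d hac hbd
    apply hq
    rcases hac with rfl | ⟨ha, hc'⟩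
    · rcases hbd with rfl | ⟨hb, hd⟩
      · exact Or.inl rfl
      · exact Or.inr ⟨(hI_ideal _ _ hb).1, (hI_ideal _ _ hd).1⟩
    · exact Or.inr ⟨(hI_ideal _ _ ha).2, (hI_ideal _ _ hc').2⟩
  · intro x y
    rfl
  · rintro ⟨x⟩ ⟨y⟩ ⟨z⟩
    exact hq _ _ (Or.inl (h_assoc x y z))
  · rintro i hi ⟨x⟩
    exact ⟨hq _ _ (Or.inr ⟨(hI_ideal x i hi).1, hi⟩), hq _ _ (Or.inr ⟨(hI_ideal x i hi).2, hi⟩)⟩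
  · rintro ⟨a⟩
    exact continuous_quot_lift _ (hc.comp (h_rcont a))
  · rintro ⟨a⟩
    exact continuous_quot_lift _ (hc.comp (h_lcont a))
  · rintro e he he' ⟨x⟩
    exact ⟨hq _ _ (Or.inl (he x)), hq _ _ (Or.inl (he' x))⟩
  · intro s hs hss hmul hsI
    have hsm : ∀ x ∈ I, s x ∈ I := fun x hx => hsI ▸ Set.mem_image_of_mem s hx
    have hw : ∀ a b : S, (reesSetoid I).r a b →
        Quotient.mk (reesSetoid I) (s a) = Quotient.mk (reesSetoid I) (s b) := by
      rintro a b (rfl | ⟨ha, hb⟩)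
      · rfl
      · exact hq _ _ (Or.inr ⟨hsm a ha, hsm b hb⟩)
    refine ⟨Quotient.lift (s := reesSetoid I) (fun x => Quotient.mk (reesSetoid I) (s x)) hw,
      fun x => rfl, ?_, ?_, ?_⟩
    · exact continuous_quot_lift _ (hc.comp hs)
    · rintro ⟨x⟩
      exact hq _ _ (Or.inl (hss x))
    · rintro ⟨x⟩ ⟨y⟩
      exact hq _ _ (Or.inl (hmul x y))
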